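/- Let A = {(1,s),(2,s−1),...,(s,1)} be the 'staircase' antichain in [m]×[n] with m, n ≥ s+1 and s ≥ 2. Then the dimension of the tangent space T_A equals sm − binom(s+1,2) + sn − binom(s+1,2) + (n−s) + (s−2) + (m−s), which equals (m−s−1)(s+1) + (n−s−1)(s+1) + (s+1)^2 − 1 + ... (i.e., the tangent space dimension equals 2·dim Gr(s+1) contributions computed by the explicit formula sm + sn − 2·binom(s+1,2) + m + n − s − 2). -/

import Mathlib

open MvPolynomial

/-- The bigrading on `k[x_1,…,x_m,y_1,…,y_n]`: `deg x_i = (1,0)`, `deg y_j = (0,1)`. -/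
def wdeg (m n : ℕ) : (Fin m ⊕ Fin n) → ℕ × ℕ :=
  Sum.elim (fun _ => ((1, 0) : ℕ × ℕ)) (fun _ => ((0, 1) : ℕ × ℕ))

/-- The monomial ideal of `k[x_1,…,x_m,y_1,…,y_n]` generated by the `x_i y_j` whose pair of
1-indexed labels lies in `O ⊆ ℕ × ℕ`. -/
noncomputable def Jof (k : Type*) [Field k] (m n : ℕ) (O : Set (ℕ × ℕ)) :
    Ideal (MvPolynomial (Fin m ⊕ Fin n) k) :=
  Ideal.span {p | ∃ (i : Fin m) (j : Fin n), ((i : ℕ) + 1, (j : ℕ) + 1) ∈ O ∧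
    p = X (Sum.inl i) * X (Sum.inr j)}

/-- The tangent space `T = [Hom_S(J, S/J)]_{(0,0)}`: the space of `S`-linear maps
`J → S/J` that preserve the bidegree (send each monomial of `J` to the class of a
bihomogeneous polynomial of the same bidegree). -/
noncomputable def TA (k : Type*) [Field k] (m n : ℕ) (O : Set (ℕ × ℕ)) :
    Submodule k (↥(Jof k m n O) →ₗ[MvPolynomial (Fin m ⊕ Fin n) k]
      (MvPolynomial (Fin m ⊕ Fin n) k ⧸ Jof k m n O)) where
  carrier := {φ | ∀ (u : (Fin m ⊕ Fin n) →₀ ℕ) (h : monomial u (1 : k) ∈ Jof k m n O),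
    ∃ p ∈ weightedHomogeneousSubmodule k (wdeg m n)
        (∑ i : Fin m, u (Sum.inl i), ∑ j : Fin n, u (Sum.inr j)),
      φ ⟨monomial u 1, h⟩ = Ideal.Quotient.mk (Jof k m n O) p}
  add_mem' := by
    intro φ ψ hφ hψ u h
    obtain ⟨p, hp, hvp⟩ := hφ u h
    obtain ⟨q, hq, hvq⟩ := hψ u h
    exact ⟨p + q, add_mem hp hq, by rw [LinearMap.add_apply, hvp, hvq, ← RingHom.map_add]⟩
  zero_mem' := by
    intro u h
    exact ⟨0, zero_mem _, by rw [LinearMap.zero_apply, RingHom.map_zero]⟩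
  smul_mem' := by
    intro c φ hφ u h
    obtain ⟨p, hp, hv⟩ := hφ u h
    refine ⟨c • p, Submodule.smul_mem _ c hp, ?_⟩
    rw [LinearMap.smul_apply, hv, ← Ideal.Quotient.mkₐ_eq_mk k, ← map_smul]

/-- The dimension of the tangent space at the Borel-fixed point `J`. -/
noncomputable def tdim (k : Type*) [Field k] (m n : ℕ) (O : Set (ℕ × ℕ)) : ℕ :=
  Module.finrank k ↥(TA k m n O)

namespace Stair

/-- The order ideal of the staircase. -/
abbrev OS (s : ℕ) : Set (ℕ × ℕ) := {v | ∃ ℓ, 1 ≤ ℓ ∧ ℓ ≤ s ∧ v.1 ≤ ℓ ∧ v.2 ≤ s + 1 - ℓ}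

lemma mem_OS (s i j : ℕ) : (i + 1, j + 1) ∈ OS s ↔ i + j < s := by
  constructor
  · rintro ⟨l, h1, h2, h3, h4⟩
    simp only at h3 h4
    omega
  · intro h
    exact ⟨i + 1, by omega, by omega, by simp, by simp only; omega⟩

/-- exponent of `x_i`. -/
noncomputable abbrev ex {m n : ℕ} (i : Fin m) : (Fin m ⊕ Fin n) →₀ ℕ := Finsupp.single (Sum.inl i) 1
/-- exponent of `y_j`. -/
noncomputable abbrev ey {m n : ℕ} (j : Fin n) : (Fin m ⊕ Fin n) →₀ ℕ := Finsupp.single (Sum.inr j) 1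

/-- exponents of monomials in the ideal -/
def InJ {m n : ℕ} (s : ℕ) (d : (Fin m ⊕ Fin n) →₀ ℕ) : Prop :=
  ∃ (i : Fin m) (j : Fin n), (i : ℕ) + j < s ∧ d (Sum.inl i) ≠ 0 ∧ d (Sum.inr j) ≠ 0

lemma le_iff {m n : ℕ} (i : Fin m) (j : Fin n) (d : (Fin m ⊕ Fin n) →₀ ℕ) :
    ex i + ey j ≤ d ↔ d (Sum.inl i) ≠ 0 ∧ d (Sum.inr j) ≠ 0 := by
  constructor
  · intro h
    have h1 := h (Sum.inl i)
    have h2 := h (Sum.inr j)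
    simp at h1 h2
    omega
  · rintro ⟨h1, h2⟩ t
    rcases t with t | t
    · by_cases h : i = t
      · subst h; simp; omega
      · simp [h]
    · by_cases h : j = t
      · subst h; simp; omega
      · simp [h]

variable {k : Type*} [Field k] {m n : ℕ} {s : ℕ}

lemma xy_eq (i : Fin m) (j : Fin n) :
    (X (Sum.inl i) * X (Sum.inr j) : MvPolynomial (Fin m ⊕ Fin n) k) = monomial (ex i + ey j) 1 := by
  simp [X, monomial_mul]

lemma mem_J (f : MvPolynomial (Fin m ⊕ Fin n) k) :
    f ∈ Jof k m n (OS s) ↔ ∀ d, coeff d f ≠ 0 → InJ s d := by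
  have : Jof k m n (OS s) = Ideal.span ((fun u => monomial u (1 : k)) ''
      {u | ∃ (i : Fin m) (j : Fin n), (i : ℕ) + j < s ∧ u = ex i + ey j}) := by
    unfold Jof
    congr 1
    ext p
    simp only [Set.mem_ofPred_eq, Set.mem_image]
    constructor
    · rintro ⟨i, j, h, rfl⟩
      exact ⟨_, ⟨i, j, (mem_OS _ _ _).1 h, rfl⟩, (xy_eq i j).symm⟩
    · rintro ⟨_, ⟨i, j, h, rfl⟩, rfl⟩
      exact ⟨i, j, (mem_OS _ _ _).2 h, (xy_eq i j).symm⟩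
  rw [this, mem_ideal_span_monomial_image]
  simp only [mem_support_iff]
  refine forall_congr' fun d => imp_congr_right fun _ => ?_
  constructor
  · rintro ⟨_, ⟨i, j, h, rfl⟩, h2⟩
    exact ⟨i, j, h, (le_iff _ _ _).1 h2⟩
  · rintro ⟨i, j, h, h2⟩
    exact ⟨_, ⟨i, j, h, rfl⟩, (le_iff _ _ _).2 h2⟩

lemma monomial_mem {d : (Fin m ⊕ Fin n) →₀ ℕ} (h : InJ s d) (c : k) :
    monomial d c ∈ Jof k m n (OS s) := by
  classical
  rw [mem_J]
  intro d' hd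
  rw [coeff_monomial] at hd
  split_ifs at hd with h1
  · exact h1 ▸ h
  · exact absurd rfl hd

lemma gen_mem {i : Fin m} {j : Fin n} (h : (i : ℕ) + j < s) :
    monomial (ex i + ey j) (1 : k) ∈ Jof k m n (OS s) :=
  monomial_mem ⟨i, j, h, by simp, by simp⟩ 1

/-- the generator as an element of the ideal -/
noncomputable def gen (k : Type*) [Field k] (i : Fin m) (j : Fin n) (h : (i : ℕ) + j < s) :
    ↥(Jof k m n (OS s)) := ⟨monomial (ex i + ey j) (1 : k), gen_mem h⟩

/-- Replace the factor `e` by `d`. -/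
noncomputable def E (k : Type*) [Field k] {m n : ℕ} (e d : (Fin m ⊕ Fin n) →₀ ℕ) :
    MvPolynomial (Fin m ⊕ Fin n) k →ₗ[k] MvPolynomial (Fin m ⊕ Fin n) k :=
  open Classical in
  (basisMonomials (Fin m ⊕ Fin n) k).constr k
    (fun u => if e ≤ u then monomial (u - e + d) 1 else 0)

open Classical in
lemma E_monomial (e d u : (Fin m ⊕ Fin n) →₀ ℕ) :
    E k e d (monomial u 1) = if e ≤ u then monomial (u - e + d) 1 else 0 := by
  have := (basisMonomials (Fin m ⊕ Fin n) k).constr_basis k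
    (fun u => if e ≤ u then monomial (u - e + d) (1 : k) else 0) u
  rw [coe_basisMonomials] at this
  exact this

/-- Condition for `E` to define a homomorphism -/
def Good (s : ℕ) (e d : (Fin m ⊕ Fin n) →₀ ℕ) : Prop :=
  ∀ (i : Fin m) (j : Fin n), (i : ℕ) + j < s → ¬ e ≤ ex i + ey j → ∀ v, e ≤ v + (ex i + ey j) →
    InJ s (v + (ex i + ey j) - e + d)

lemma E_mul {e d : (Fin m ⊕ Fin n) →₀ ℕ} (hg : Good s e d) (f : MvPolynomial (Fin m ⊕ Fin n) k)
    (hf : f ∈ Jof k m n (OS s)) :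
    ∀ r, E k e d (r * f) - r * E k e d f ∈ Jof k m n (OS s) := by
  classical
  unfold Jof at hf
  induction hf using Submodule.span_induction with
  | mem x hx =>
    obtain ⟨i, j, h, rfl⟩ := hx
    rw [mem_OS] at h
    rw [xy_eq]
    intro r
    induction r using MvPolynomial.induction_on' with
    | monomial v c =>
      have hc : monomial v c = c • monomial v (1 : k) := by simp [smul_monomial]
      rw [hc, smul_mul_assoc, smul_mul_assoc, map_smul, ← smul_sub]
      apply Submodule.smul_of_tower_mem
      rw [monomial_mul, one_mul, E_monomial, E_monomial]
      by_cases h1 : e ≤ ex i + ey j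
      · rw [if_pos h1, if_pos (h1.trans le_add_self), monomial_mul, one_mul,
          add_tsub_assoc_of_le h1, add_assoc, sub_self]
        exact zero_mem _
      · rw [if_neg h1, mul_zero, sub_zero]
        split_ifs with h2
        · exact monomial_mem (hg i j h h1 v h2) 1
        · exact zero_mem _
    | add p q hp hq =>
      have : E k e d ((p + q) * monomial (ex i + ey j) 1) - (p + q) * E k e d (monomial (ex i + ey j) 1)
        = (E k e d (p * monomial (ex i + ey j) 1) - p * E k e d (monomial (ex i + ey j) 1)) +
          (E k e d (q * monomial (ex i + ey j) 1) - q * E k e d (monomial (ex i + ey j) 1)) := by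
        rw [add_mul, map_add]; ring
      rw [this]
      exact add_mem hp hq
  | zero => intro r; simp
  | add x y hx hy h1 h2 =>
    intro r
    have : E k e d (r * (x + y)) - r * E k e d (x + y) =
      (E k e d (r * x) - r * E k e d x) + (E k e d (r * y) - r * E k e d y) := by
      rw [mul_add, map_add, map_add]; ring
    rw [this]
    exact add_mem (h1 r) (h2 r)
  | smul a x hx h =>
    intro r
    have : E k e d (r * (a • x)) - r * E k e d (a • x) =
      (E k e d ((r * a) * x) - (r * a) * E k e d x) - r * (E k e d (a * x) - a * E k e d x) := by
      rw [smul_eq_mul, mul_assoc]; ring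
    rw [this]
    exact sub_mem (h _) (Ideal.mul_mem_left _ _ (h _))

/-- The homomorphism `J → S/J` induced by `E`. -/
noncomputable def EH (k : Type*) [Field k] {e d : (Fin m ⊕ Fin n) →₀ ℕ} (hg : Good s e d) :
    ↥(Jof k m n (OS s)) →ₗ[MvPolynomial (Fin m ⊕ Fin n) k]
      (MvPolynomial (Fin m ⊕ Fin n) k ⧸ Jof k m n (OS s)) where
  toFun f := Ideal.Quotient.mk _ (E k e d f)
  map_add' f g := by simp
  map_smul' r f := by
    have h := E_mul hg f.1 f.2 r
    rw [← Ideal.Quotient.eq] at h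
    simp only [RingHom.id_apply, SetLike.val_smul, smul_eq_mul]
    rw [h, map_mul]
    rfl

lemma weight_eq (u : (Fin m ⊕ Fin n) →₀ ℕ) : Finsupp.weight (wdeg m n) u =
    (∑ i : Fin m, u (Sum.inl i), ∑ j : Fin n, u (Sum.inr j)) := by
  rw [Finsupp.weight_apply, Finsupp.sum_fintype _ _ (by simp), Fintype.sum_sum_type]
  simp [wdeg, Prod.ext_iff, Prod.fst_sum, Prod.snd_sum]

lemma EH_mem {e d : (Fin m ⊕ Fin n) →₀ ℕ} (hg : Good s e d)
    (hw : Finsupp.weight (wdeg m n) e = Finsupp.weight (wdeg m n) d) :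
    EH k hg ∈ TA k m n (OS s) := by
  classical
  intro u h
  refine ⟨E k e d (monomial u 1), ?_, rfl⟩
  rw [E_monomial]
  split_ifs with h1
  · rw [mem_weightedHomogeneousSubmodule]
    apply isWeightedHomogeneous_monomial
    rw [map_add, ← hw, ← map_add, tsub_add_cancel_of_le h1, weight_eq]
  · exact zero_mem _

/-- The coefficient functional on the quotient -/
noncomputable def cf (k : Type*) [Field k] {m n s : ℕ} (d : (Fin m ⊕ Fin n) →₀ ℕ) (hd : ¬ InJ s d) :
    (MvPolynomial (Fin m ⊕ Fin n) k ⧸ Jof k m n (OS s)) →ₗ[k] k :=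
  (((Jof k m n (OS s)).restrictScalars k).liftQ (lcoeff k d) (by
    intro f hf
    rw [Submodule.restrictScalars_mem, mem_J] at hf
    by_contra h
    exact hd (hf d h))) ∘ₗ
  (Submodule.Quotient.restrictScalarsEquiv k (Jof k m n (OS s))).symm.toLinearMap

lemma cf_mk (d : (Fin m ⊕ Fin n) →₀ ℕ) (hd : ¬ InJ s d) (p : MvPolynomial (Fin m ⊕ Fin n) k) :
    cf k d hd (Ideal.Quotient.mk _ p) = coeff d p := rfl

lemma cf_X_mul (d : (Fin m ⊕ Fin n) →₀ ℕ) (t) (hd : ¬ InJ s d)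
    (hd' : ¬ InJ s (Finsupp.single t 1 + d))
    (q : MvPolynomial (Fin m ⊕ Fin n) k ⧸ Jof k m n (OS s)) :
    cf k (Finsupp.single t 1 + d) hd' ((X t : MvPolynomial (Fin m ⊕ Fin n) k) • q) = cf k d hd q := by
  obtain ⟨p, rfl⟩ := Ideal.Quotient.mk_surjective q
  have : (X t : MvPolynomial (Fin m ⊕ Fin n) k) • (Ideal.Quotient.mk (Jof k m n (OS s)) p)
    = Ideal.Quotient.mk (Jof k m n (OS s)) (X t * p) := rfl
  rw [this, cf_mk, cf_mk, coeff_X_mul]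

lemma cf_X_mul_zero (d : (Fin m ⊕ Fin n) →₀ ℕ) (t) (hd : ¬ InJ s d) (ht : d t = 0)
    (q : MvPolynomial (Fin m ⊕ Fin n) k ⧸ Jof k m n (OS s)) :
    cf k d hd ((X t : MvPolynomial (Fin m ⊕ Fin n) k) • q) = 0 := by
  classical
  obtain ⟨p, rfl⟩ := Ideal.Quotient.mk_surjective q
  have : (X t : MvPolynomial (Fin m ⊕ Fin n) k) • (Ideal.Quotient.mk (Jof k m n (OS s)) p)
    = Ideal.Quotient.mk (Jof k m n (OS s)) (X t * p) := rfl
  rw [this, cf_mk, coeff_X_mul']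
  simp [ht]

lemma not_InJ_xy {a : Fin m} {b : Fin n} (h : s ≤ (a : ℕ) + b) : ¬ InJ s (ex a + ey b) := by
  rintro ⟨i, j, h1, h2, h3⟩
  simp [Finsupp.single_apply] at h2 h3
  subst h2 h3
  omega

lemma not_InJ_xxy {i a : Fin m} {b : Fin n} (h : s ≤ (a : ℕ) + b) (h' : s ≤ (i : ℕ) + b) :
    ¬ InJ s (ex i + (ex a + ey b)) := by
  rintro ⟨i', j, h1, h2, h3⟩
  simp [Finsupp.single_apply] at h2 h3
  subst h3
  by_cases h4 : i = i'
  · subst h4; omega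
  · have := h2 h4
    subst this
    omega

lemma not_InJ_yxy {j b : Fin n} {a : Fin m} (h : s ≤ (a : ℕ) + b) (h' : s ≤ (a : ℕ) + j) :
    ¬ InJ s (ey j + (ex a + ey b)) := by
  rintro ⟨i, j', h1, h2, h3⟩
  simp [Finsupp.single_apply] at h2 h3
  subst h2
  by_cases h4 : j = j'
  · subst h4; omega
  · have := h3 h4
    subst this
    omega

abbrev HomJ (k : Type*) [Field k] (m n s : ℕ) :=
  ↥(Jof k m n (OS s)) →ₗ[MvPolynomial (Fin m ⊕ Fin n) k]
      (MvPolynomial (Fin m ⊕ Fin n) k ⧸ Jof k m n (OS s))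

/-- The coefficient of `x_a y_b` in `φ (x_i y_j)`. -/
noncomputable def C (φ : HomJ k m n s) (i : Fin m) (j : Fin n) (h : (i : ℕ) + j < s)
    (a : Fin m) (b : Fin n) (h' : s ≤ (a : ℕ) + b) : k :=
  cf k (ex a + ey b) (not_InJ_xy h') (φ (gen k i j h))

lemma rel_x (φ : HomJ k m n s) (i i' : Fin m) (j : Fin n) (h : (i : ℕ) + j < s)
    (h' : (i' : ℕ) + j < s) :
    (X (Sum.inl i') : MvPolynomial (Fin m ⊕ Fin n) k) • φ (gen k i j h) =
    (X (Sum.inl i) : MvPolynomial (Fin m ⊕ Fin n) k) • φ (gen k i' j h') := by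
  rw [← map_smul, ← map_smul]
  congr 1
  apply Subtype.ext
  simp only [gen, SetLike.val_smul, smul_eq_mul, ← xy_eq]
  ring

lemma rel_y (φ : HomJ k m n s) (i : Fin m) (j j' : Fin n) (h : (i : ℕ) + j < s)
    (h' : (i : ℕ) + j' < s) :
    (X (Sum.inr j') : MvPolynomial (Fin m ⊕ Fin n) k) • φ (gen k i j h) =
    (X (Sum.inr j) : MvPolynomial (Fin m ⊕ Fin n) k) • φ (gen k i j' h') := by
  rw [← map_smul, ← map_smul]
  congr 1
  apply Subtype.ext
  simp only [gen, SetLike.val_smul, smul_eq_mul, ← xy_eq]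
  ring

lemma cf_congr {d d' : (Fin m ⊕ Fin n) →₀ ℕ} (h : d = d') (hd : ¬ InJ s d) (hd' : ¬ InJ s d') (q) :
    cf k d hd q = cf k d' hd' q := by
  subst h; rfl

lemma C_lin_x (φ : HomJ k m n s) (i : Fin m) (j j' : Fin n) (h : (i : ℕ) + j < s)
    (h' : (i : ℕ) + j' < s) (a : Fin m) (ha : s ≤ (a : ℕ) + j) (ha' : s ≤ (a : ℕ) + j') :
    C φ i j h a j ha = C φ i j' h' a j' ha' := by
  unfold C
  rw [← cf_X_mul (ex a + ey j) (Sum.inr j') _ (not_InJ_yxy ha ha'),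
    ← cf_X_mul (ex a + ey j') (Sum.inr j) _ (not_InJ_yxy ha' ha), rel_y φ i j j' h h']
  exact cf_congr (by abel) _ _ _

lemma C_lin_y (φ : HomJ k m n s) (i i' : Fin m) (j : Fin n) (h : (i : ℕ) + j < s)
    (h' : (i' : ℕ) + j < s) (b : Fin n) (ha : s ≤ (i : ℕ) + b) (ha' : s ≤ (i' : ℕ) + b) :
    C φ i j h i b ha = C φ i' j h' i' b ha' := by
  unfold C
  rw [← cf_X_mul (ex i + ey b) (Sum.inl i') _ (not_InJ_xxy ha ha'),
    ← cf_X_mul (ex i' + ey b) (Sum.inl i) _ (not_InJ_xxy ha' ha), rel_x φ i i' j h h']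
  exact cf_congr (by abel) _ _ _

lemma C_zero_x (φ : HomJ k m n s) (i i' : Fin m) (j : Fin n) (h : (i : ℕ) + j < s)
    (h' : (i' : ℕ) + j < s) (a : Fin m) (b : Fin n) (hab : s ≤ (a : ℕ) + b)
    (hi : i' ≠ i) (hai : a ≠ i) (hb : s ≤ (i' : ℕ) + b) :
    C φ i j h a b hab = 0 := by
  unfold C
  rw [← cf_X_mul (ex a + ey b) (Sum.inl i') _ (not_InJ_xxy hab hb), rel_x φ i i' j h h']
  apply cf_X_mul_zero
  simp [hi, hai]

lemma C_zero_y (φ : HomJ k m n s) (i : Fin m) (j j' : Fin n) (h : (i : ℕ) + j < s)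
    (h' : (i : ℕ) + j' < s) (a : Fin m) (b : Fin n) (hab : s ≤ (a : ℕ) + b)
    (hj : j' ≠ j) (hbj : b ≠ j) (hb : s ≤ (a : ℕ) + j') :
    C φ i j h a b hab = 0 := by
  unfold C
  rw [← cf_X_mul (ex a + ey b) (Sum.inr j') _ (not_InJ_yxy hab hb), rel_y φ i j j' h h']
  apply cf_X_mul_zero
  simp [hj, hbj]

/-- The index predicate. -/
def P (s i a b : ℕ) : Prop :=
  (b = s - 1 - i ∧ i < a) ∨ (a = i ∧ s - 1 - i < b) ∨ (i = 0 ∧ a = 1 ∧ s ≤ b) ∨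
  (0 < i ∧ i + 1 < s ∧ a = i + 1 ∧ b = s - i) ∨ (i + 1 = s ∧ b = 1 ∧ s ≤ a)

lemma corner {s i j a b : ℕ} (hij : i + j < s) (hab : s ≤ a + b) (ha : a ≠ i) (hb : b ≠ j)
    (q1 : ∀ t : ℕ, t ≠ i → t + j < s → t + b < s) (q2 : ∀ t : ℕ, t ≠ j → i + t < s → a + t < s) :
    i + j + 1 = s := by
  by_contra hc
  have r1 := q1 (s - 1 - j) (by omega) (by omega)
  have r2 := q2 (s - 1 - i) (by omega) (by omega)
  omega

lemma P_of {s i j a b : ℕ} (hs : 2 ≤ s) (hij : i + j + 1 = s) (hab : s ≤ a + b) (ha : a ≠ i)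
    (hb : b ≠ j)
    (q1 : ∀ t : ℕ, t ≠ i → t + j < s → t + b < s) (q2 : ∀ t : ℕ, t ≠ j → i + t < s → a + t < s) :
    P s i a b := by
  right; right
  by_cases hi : i = 0
  · left
    have r2 := q2 (s - 2) (by omega) (by omega)
    omega
  right
  have r1 := q1 (i - 1) (by omega) (by omega)
  by_cases hj : j = 0
  · right
    omega
  left
  have r2 := q2 (j - 1) (by omega) (by omega)
  omega

lemma P_le {s i a b : ℕ} (hi : i < s) (h : P s i a b) : s ≤ a + b := by
  unfold P at h; omega

lemma exp_of_weight {d : (Fin m ⊕ Fin n) →₀ ℕ}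
    (h : (∑ i : Fin m, d (Sum.inl i), ∑ j : Fin n, d (Sum.inr j)) = ((1, 1) : ℕ × ℕ)) :
    ∃ a b, d = ex a + ey b := by
  simp only [Prod.mk.injEq] at h
  obtain ⟨h1, h2⟩ := h
  obtain ⟨a, ha⟩ : ∃ a : Fin m, d (Sum.inl a) ≠ 0 := by
    by_contra! hc
    simp [hc] at h1
  obtain ⟨b, hb⟩ : ∃ b : Fin n, d (Sum.inr b) ≠ 0 := by
    by_contra! hc
    simp [hc] at h2
  refine ⟨a, b, ?_⟩
  rw [← Finset.add_sum_erase _ _ (Finset.mem_univ a)] at h1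
  rw [← Finset.add_sum_erase _ _ (Finset.mem_univ b)] at h2
  have e1 : ∑ x ∈ Finset.univ.erase a, d (Sum.inl x) = 0 := by omega
  have e2 : ∑ x ∈ Finset.univ.erase b, d (Sum.inr x) = 0 := by omega
  rw [Finset.sum_eq_zero_iff] at e1 e2
  ext t
  rcases t with t | t
  · by_cases h : a = t
    · subst h; simp; omega
    · simp [h, e1 t (by simp [Ne.symm h])]
  · by_cases h : b = t
    · subst h; simp; omega
    · simp [h, e2 t (by simp [Ne.symm h])]

lemma eq_zero_of_C (φ : HomJ k m n s) (hφ : φ ∈ TA k m n (OS s))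
    (h : ∀ i j hij a b hab, C φ i j hij a b hab = 0) : φ = 0 := by
  have hg : ∀ i j hij, φ (gen k i j hij) = 0 := by
    intro i j hij
    obtain ⟨p, hp, hv⟩ := hφ (ex i + ey j) (gen_mem hij)
    change φ (gen k i j hij) = _ at hv
    rw [hv, Ideal.Quotient.eq_zero_iff_mem, mem_J]
    intro d hd
    by_contra hJ
    rw [mem_weightedHomogeneousSubmodule] at hp
    have h1 := hp hd
    rw [weight_eq] at h1
    have h2 : (∑ i : Fin m, d (Sum.inl i), ∑ j : Fin n, d (Sum.inr j)) = ((1, 1) : ℕ × ℕ) := by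
      rw [h1]; simp [Finsupp.single_apply]
    obtain ⟨a, b, rfl⟩ := exp_of_weight h2
    have hab : s ≤ (a : ℕ) + b := by
      by_contra hc
      exact hJ ⟨a, b, by omega, by simp, by simp⟩
    have := h i j hij a b hab
    unfold C at this
    rw [hv, cf_mk] at this
    exact hd this
  have key : ∀ f (hf : f ∈ Jof k m n (OS s)), φ ⟨f, hf⟩ = 0 := by
    intro f hf
    have hf' := hf
    unfold Jof at hf'
    induction hf' using Submodule.span_induction with
    | mem x hx =>
      obtain ⟨i, j, h, rfl⟩ := hx
      rw [mem_OS] at h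
      rw [← hg i j h]
      congr 1
      exact Subtype.ext (xy_eq i j)
    | zero => exact map_zero φ
    | add x y hx hy h1 h2 =>
      have := map_add φ ⟨x, show x ∈ Jof k m n (OS s) from hx⟩ ⟨y, show y ∈ Jof k m n (OS s) from hy⟩
      rw [h1, h2, add_zero] at this
      exact this
    | smul a x hx h1 =>
      have := map_smul φ a ⟨x, show x ∈ Jof k m n (OS s) from hx⟩
      rw [h1, smul_zero] at this
      exact this
  ext f
  exact key f.1 f.2

lemma eq_zero_of_P (hs : 2 ≤ s) (hm : s + 1 ≤ m) (hn : s + 1 ≤ n)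
    (φ : HomJ k m n s) (hφ : φ ∈ TA k m n (OS s))
    (h : ∀ (i : Fin m) (j : Fin n) (hij : (i : ℕ) + j < s) (a : Fin m) (b : Fin n)
      (hab : s ≤ (a : ℕ) + b), (i : ℕ) + j + 1 = s → P s i a b → C φ i j hij a b hab = 0) :
    φ = 0 := by
  apply eq_zero_of_C φ hφ
  intro i j hij a b hab
  by_cases hb : b = j
  · subst hb
    have hj : s - 1 - (i : ℕ) < n := by omega
    rw [C_lin_x φ i b ⟨s - 1 - i, hj⟩ hij (by simp only; omega) a hab (by simp only; omega)]
    apply h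
    · simp only; omega
    · left; exact ⟨rfl, by omega⟩
  by_cases ha : a = i
  · subst ha
    have hj : s - 1 - (j : ℕ) < m := by omega
    rw [C_lin_y φ a ⟨s - 1 - j, hj⟩ j hij (by simp only; omega) b hab (by simp only; omega)]
    apply h
    · simp only; omega
    · right; left; exact ⟨rfl, by simp only; omega⟩
  by_cases h1 : ∃ i' : Fin m, i' ≠ i ∧ (i' : ℕ) + j < s ∧ s ≤ (i' : ℕ) + b
  · obtain ⟨i', h1, h2, h3⟩ := h1
    exact C_zero_x φ i i' j hij h2 a b hab h1 ha h3
  by_cases h2 : ∃ j' : Fin n, j' ≠ j ∧ (i : ℕ) + j' < s ∧ s ≤ (a : ℕ) + j'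
  · obtain ⟨j', h1, h2, h3⟩ := h2
    exact C_zero_y φ i j j' hij h2 a b hab h1 hb h3
  push Not at h1 h2
  have q1 : ∀ t : ℕ, t ≠ i → t + j < s → t + b < s := fun t ht ht' => by
    have := h1 ⟨t, by omega⟩ (by simpa [Fin.ext_iff] using ht) ht'
    exact this
  have q2 : ∀ t : ℕ, t ≠ j → i + t < s → a + t < s := fun t ht ht' => by
    have := h2 ⟨t, by omega⟩ (by simpa [Fin.ext_iff] using ht) ht'
    exact this
  have ha' : (a : ℕ) ≠ i := fun h => ha (Fin.ext h)
  have hb' : (b : ℕ) ≠ j := fun h => hb (Fin.ext h)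
  apply h
  · exact corner hij hab ha' hb' q1 q2
  · exact P_of hs (corner hij hab ha' hb' q1 q2) hab ha' hb' q1 q2

/-- index type -/
abbrev Ix (m n s : ℕ) := {t : Fin s × Fin m × Fin n // P s t.1 t.2.1 t.2.2}

lemma good_x (i a : Fin m) : Good (n := n) s (ex i) (ex a) := by
  intro i' j' h h1 v h2
  have hi : i' ≠ i := by
    rintro rfl
    exact h1 le_self_add
  refine ⟨i', j', h, ?_, ?_⟩ <;> simp [hi.symm]

lemma good_y (j b : Fin n) : Good (m := m) s (ey j) (ey b) := by
  intro i' j' h h1 v h2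
  have hi : j' ≠ j := by
    rintro rfl
    exact h1 le_add_self
  refine ⟨i', j', h, ?_, ?_⟩ <;> simp [hi.symm]

lemma good_xy (i a : Fin m) (j b : Fin n) (hij : (i : ℕ) + j + 1 = s)
    (ha : (i : ℕ) + 1 = s ∨ (a : ℕ) = i + 1) (hb : (j : ℕ) + 1 = s ∨ (b : ℕ) = j + 1) :
    Good s (ex i + ey j) (ex a + ey b) := by
  intro i' j' h h1 v h2
  by_cases hi : i' = i
  · subst hi
    have hj : j' ≠ j := by
      rintro rfl
      exact h1 le_rfl
    have hj' : (j' : ℕ) ≠ j := fun h => hj (Fin.ext h)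
    refine ⟨a, j', by omega, ?_, ?_⟩ <;> simp [hj.symm]
  · have hi' : (i' : ℕ) ≠ i := fun h => hi (Fin.ext h)
    by_cases hj : j' = j
    · subst hj
      refine ⟨i', b, by omega, ?_, ?_⟩ <;> simp [Ne.symm hi]
    · refine ⟨i', j', h, ?_, ?_⟩ <;> simp [Ne.symm hi, Ne.symm hj]

lemma weight_ex (i : Fin m) : Finsupp.weight (wdeg m n) (ex i) = (1, 0) := by
  simp [Finsupp.weight_single, wdeg]

lemma weight_ey (i : Fin n) : Finsupp.weight (wdeg m n) (ey i) = (0, 1) := by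
  simp [Finsupp.weight_single, wdeg]

lemma exy_inj {a a' : Fin m} {b b' : Fin n} (h : (ex a + ey b : (Fin m ⊕ Fin n) →₀ ℕ) = ex a' + ey b') :
    a = a' ∧ b = b' := by
  have h1 := DFunLike.congr_fun h (Sum.inl a)
  have h2 := DFunLike.congr_fun h (Sum.inr b)
  simp [Finsupp.single_apply] at h1 h2
  exact ⟨h1.symm, h2.symm⟩

lemma C_EH {e d r : (Fin m ⊕ Fin n) →₀ ℕ} (hg : Good s e d) (i : Fin m) (j : Fin n)
    (a : Fin m) (b : Fin n) (hij : (i : ℕ) + j < s)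
    (h1 : e + r = ex i + ey j) (h2 : d + r = ex a + ey b) (a' : Fin m) (b' : Fin n) (hab)
    [Decidable (a = a' ∧ b = b')] :
    C (EH k hg) i j hij a' b' hab = if a = a' ∧ b = b' then 1 else 0 := by
  classical
  unfold C
  change cf k _ _ (Ideal.Quotient.mk _ (E k e d (monomial (ex i + ey j) 1))) = _
  rw [cf_mk, E_monomial, if_pos (by rw [← h1]; exact le_self_add), ← h1, add_tsub_cancel_left,
    add_comm r d, h2, coeff_monomial]
  by_cases h : a = a' ∧ b = b'
  · rw [if_pos h, if_pos (by rw [h.1, h.2])]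
  · rw [if_neg h, if_neg (fun h' => h (exy_inj h'))]

lemma C_EH_zero {e d : (Fin m ⊕ Fin n) →₀ ℕ} (hg : Good s e d) (i : Fin m) (j : Fin n)
    (hij : (i : ℕ) + j < s) (h : ¬ e ≤ ex i + ey j) (a' : Fin m) (b' : Fin n) (hab) :
    C (EH k hg) i j hij a' b' hab = 0 := by
  classical
  unfold C
  change cf k _ _ (Ideal.Quotient.mk _ (E k e d (monomial (ex i + ey j) 1))) = _
  rw [cf_mk, E_monomial, if_neg h, coeff_zero]

lemma exists_tau (hs : 2 ≤ s) (i : Fin m) (j : Fin n) (a : Fin m) (b : Fin n)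
    (hij : (i : ℕ) + j + 1 = s) (hP : P s i a b) :
    ∃ φ ∈ TA k m n (OS s), ∀ (i' : Fin m) (j' : Fin n) (hij' : (i' : ℕ) + j' < s)
      (a' : Fin m) (b' : Fin n) (hab' : s ≤ (a' : ℕ) + b'), (i' : ℕ) + j' + 1 = s →
      C φ i' j' hij' a' b' hab' = if i = i' ∧ a = a' ∧ b = b' then 1 else 0 := by
  classical
  suffices H : ∃ (e d r : (Fin m ⊕ Fin n) →₀ ℕ), Good s e d ∧
      Finsupp.weight (wdeg m n) e = Finsupp.weight (wdeg m n) d ∧ e + r = ex i + ey j ∧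
      d + r = ex a + ey b ∧ (ex i ≤ e ∨ ey j ≤ e) by
    obtain ⟨e, d, r, hg, hw, h1, h2, h3⟩ := H
    refine ⟨EH k hg, EH_mem hg hw, ?_⟩
    intro i' j' hij' a' b' hab' hc
    by_cases hi : i = i'
    · subst hi
      have : j' = j := Fin.ext (by omega)
      subst this
      rw [C_EH hg i j' a b hij' h1 h2]
      simp
    · rw [C_EH_zero, if_neg (fun h => hi h.1)]
      intro hle
      have hj : j ≠ j' := by
        rintro rfl
        exact hi (Fin.ext (by omega))
      rcases h3 with h3 | h3
      · have := (h3.trans hle) (Sum.inl i)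
        simp [Ne.symm hi] at this
      · have := (h3.trans hle) (Sum.inr j)
        simp [Ne.symm hj] at this
  by_cases hb : b = j
  · subst hb
    exact ⟨ex i, ex a, ey b, good_x i a, by rw [weight_ex, weight_ex], rfl, rfl, Or.inl le_rfl⟩
  by_cases ha : a = i
  · subst ha
    exact ⟨ey j, ey b, ex a, good_y j b, by rw [weight_ey, weight_ey], add_comm _ _, add_comm _ _,
      Or.inr le_rfl⟩
  have ha' : (a : ℕ) ≠ i := fun h => ha (Fin.ext h)
  have hb' : (b : ℕ) ≠ j := fun h => hb (Fin.ext h)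
  refine ⟨ex i + ey j, ex a + ey b, 0, good_xy i a j b hij ?_ ?_, ?_, add_zero _, add_zero _,
    Or.inl le_self_add⟩
  · unfold P at hP; omega
  · unfold P at hP; omega
  · simp only [map_add, weight_ex, weight_ey]

lemma C_add (φ ψ : HomJ k m n s) (i j h a b h') :
    C (φ + ψ) i j h a b h' = C φ i j h a b h' + C ψ i j h a b h' := by
  simp [C]

lemma C_smul (c : k) (φ : HomJ k m n s) (i j h a b h') :
    C (c • φ) i j h a b h' = c * C φ i j h a b h' := by
  simp [C]

/-- The coordinate map. -/
noncomputable def coord (k : Type*) [Field k] (hm : s + 1 ≤ m) (hn : s + 1 ≤ n) :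
    ↥(TA k m n (OS s)) →ₗ[k] (Ix m n s → k) where
  toFun φ t := C φ.1 ⟨t.1.1, by omega⟩ ⟨s - 1 - t.1.1, by omega⟩ (by simp only; omega) t.1.2.1 t.1.2.2
    (P_le t.1.1.2 t.2)
  map_add' φ ψ := by funext t; exact C_add _ _ _ _ _ _ _ _
  map_smul' c φ := by funext t; exact C_smul _ _ _ _ _ _ _ _

lemma coord_inj (hs : 2 ≤ s) (hm : s + 1 ≤ m) (hn : s + 1 ≤ n) :
    Function.Injective (coord k hm hn) := by
  rw [injective_iff_map_eq_zero]
  intro φ h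
  apply Subtype.ext
  apply eq_zero_of_P hs hm hn φ.1 φ.2
  intro i j hij a b hab hc hP
  have := congrFun h ⟨(⟨i, by omega⟩, a, b), hP⟩
  have hj : j = ⟨s - 1 - i, by omega⟩ := Fin.ext (by simp only; omega)
  have key : ∀ j' : Fin n, j = j' → ∀ hij', C φ.1 i j' hij' a b hab = 0 → C φ.1 i j hij a b hab = 0 := by
    rintro _ rfl _ h
    exact h
  exact key _ hj _ this

lemma coord_surj (hs : 2 ≤ s) (hm : s + 1 ≤ m) (hn : s + 1 ≤ n) :
    Function.Surjective (coord k hm hn) := by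
  classical
  have H : ∀ t : Ix m n s, ∃ φ : ↥(TA k m n (OS s)), coord k hm hn φ = Pi.single t 1 := by
    intro t
    obtain ⟨φ, h1, h2⟩ := exists_tau (k := k) hs (⟨t.1.1, by omega⟩ : Fin m)
      (⟨s - 1 - t.1.1, by omega⟩ : Fin n) t.1.2.1 t.1.2.2 (by simp only; omega) t.2
    refine ⟨⟨φ, h1⟩, ?_⟩
    funext t'
    refine (h2 _ _ _ _ _ (P_le t'.1.1.2 t'.2) (by simp only; omega)).trans ?_
    rw [Pi.single_apply]
    congr 1
    simp only [Subtype.ext_iff, Prod.ext_iff, Fin.ext_iff, eq_iff_iff]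
    constructor <;> rintro ⟨h1, h2, h3⟩ <;> exact ⟨h1.symm, h2.symm, h3.symm⟩
  choose τ hτ using H
  intro c
  refine ⟨∑ t, c t • τ t, ?_⟩
  rw [map_sum]
  simp only [map_smul, hτ]
  exact (pi_eq_sum_univ' c).symm

lemma finrank_TA (hs : 2 ≤ s) (hm : s + 1 ≤ m) (hn : s + 1 ≤ n) [Fintype (Ix m n s)] :
    tdim k m n (OS s) = Fintype.card (Ix m n s) := by
  unfold tdim
  rw [(LinearEquiv.ofBijective (coord k hm hn) ⟨coord_inj hs hm hn, coord_surj hs hm hn⟩).finrank_eq,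
    Module.finrank_fintype_fun_eq_card]

abbrev Sx (m n s : ℕ) := ((i : Fin s) × Fin (m - 1 - i)) ⊕ ((i : Fin s) × Fin (n - s + i)) ⊕
  Fin (n - s) ⊕ Fin (s - 2) ⊕ Fin (m - s)

lemma P1 {s i a : ℕ} (h : i < a) : P s i a (s - 1 - i) := Or.inl ⟨rfl, h⟩
lemma P2 {s i b : ℕ} (h : s - 1 - i < b) : P s i i b := Or.inr (Or.inl ⟨rfl, h⟩)
lemma P3 {s b : ℕ} (h : s ≤ b) : P s 0 1 b := Or.inr (Or.inr (Or.inl ⟨rfl, rfl, h⟩))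
lemma P4 {s i : ℕ} (h0 : 0 < i) (h : i + 1 < s) : P s i (i + 1) (s - i) :=
  Or.inr (Or.inr (Or.inr (Or.inl ⟨h0, h, rfl, rfl⟩)))
lemma P5 {s a : ℕ} (h0 : 0 < s) (h : s ≤ a) : P s (s - 1) a 1 :=
  Or.inr (Or.inr (Or.inr (Or.inr ⟨by omega, rfl, h⟩)))

def toIx (hs : 2 ≤ s) (hm : s + 1 ≤ m) (hn : s + 1 ≤ n) : Sx m n s → Ix m n s
  | .inl ⟨i, t⟩ => ⟨(i, ⟨i + 1 + t, by omega⟩, ⟨s - 1 - i, by omega⟩), P1 (by dsimp only; omega)⟩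
  | .inr (.inl ⟨i, t⟩) => ⟨(i, ⟨i, by omega⟩, ⟨s - i + t, by omega⟩), P2 (by dsimp only; omega)⟩
  | .inr (.inr (.inl t)) => ⟨(⟨0, by omega⟩, ⟨1, by omega⟩, ⟨s + t, by omega⟩), P3 (by dsimp only; omega)⟩
  | .inr (.inr (.inr (.inl t))) =>
      ⟨(⟨t + 1, by omega⟩, ⟨t + 2, by omega⟩, ⟨s - (t + 1), by omega⟩), P4 (by dsimp only; omega) (by dsimp only; omega)⟩
  | .inr (.inr (.inr (.inr t))) =>
      ⟨(⟨s - 1, by omega⟩, ⟨s + t, by omega⟩, ⟨1, by omega⟩), P5 (by omega) (by dsimp only; omega)⟩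

lemma toIx_bij (hs : 2 ≤ s) (hm : s + 1 ≤ m) (hn : s + 1 ≤ n) :
    Function.Bijective (toIx hs hm hn) := by
  constructor
  · rintro (⟨i, t⟩ | ⟨i, t⟩ | t | t | t) (⟨i', t'⟩ | ⟨i', t'⟩ | t' | t' | t') h <;>
      simp only [toIx, Subtype.mk.injEq, Prod.mk.injEq, Fin.ext_iff] at h
    · obtain ⟨h1, h2, h3⟩ := h
      have : i = i' := Fin.ext h1
      subst this
      have : t = t' := Fin.ext (by omega)
      rw [this]
    all_goals try (exfalso; omega)
    · obtain ⟨h1, h2, h3⟩ := h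
      have : i = i' := Fin.ext h1
      subst this
      have : t = t' := Fin.ext (by omega)
      rw [this]
    all_goals
      have : t = t' := Fin.ext (by omega)
      rw [this]
  · rintro ⟨⟨i, a, b⟩, h⟩
    have h' := h
    simp only [P] at h'
    rcases h' with h' | h' | h' | h' | h'
    · refine ⟨.inl ⟨i, ⟨a - i - 1, by omega⟩⟩, ?_⟩
      simp only [toIx, Subtype.mk.injEq, Prod.mk.injEq, Fin.ext_iff, true_and]; omega
    · refine ⟨.inr (.inl ⟨i, ⟨b - (s - i), by omega⟩⟩), ?_⟩
      simp only [toIx, Subtype.mk.injEq, Prod.mk.injEq, Fin.ext_iff, true_and]; omega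
    · refine ⟨.inr (.inr (.inl ⟨b - s, by omega⟩)), ?_⟩
      simp only [toIx, Subtype.mk.injEq, Prod.mk.injEq, Fin.ext_iff, true_and]; omega
    · refine ⟨.inr (.inr (.inr (.inl ⟨i - 1, by omega⟩))), ?_⟩
      simp only [toIx, Subtype.mk.injEq, Prod.mk.injEq, Fin.ext_iff, true_and]; omega
    · refine ⟨.inr (.inr (.inr (.inr ⟨a - s, by omega⟩))), ?_⟩
      simp only [toIx, Subtype.mk.injEq, Prod.mk.injEq, Fin.ext_iff, true_and]; omega

lemma sum1 (m s : ℕ) (hm : s + 1 ≤ m) :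
    ∑ i : Fin s, (m - 1 - (i : ℕ)) + (s + 1).choose 2 = s * m := by
  rw [Fin.sum_univ_eq_sum_range (fun i => m - 1 - i) s]
  induction s with
  | zero => simp
  | succ s ih =>
    have := ih (by omega)
    rw [Finset.sum_range_succ, Nat.choose_succ_succ' (s + 1) 1, Nat.choose_one_right, add_mul]
    norm_num only at *
    omega

lemma sum2 (n s : ℕ) (hn : s + 1 ≤ n) :
    ∑ i : Fin s, (n - s + (i : ℕ)) + (s + 1).choose 2 = s * n := by
  rw [← sum1 n s hn, ← Equiv.sum_comp Fin.revPerm]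
  congr 1
  apply Finset.sum_congr rfl
  intro i _
  simp only [Fin.revPerm_apply, Fin.val_rev]
  omega

lemma arith (m n s c : ℕ) (hs : 2 ≤ s) (hm : s + 1 ≤ m) (hn : s + 1 ≤ n)
    (hc : 2 * c = s * (s + 1)) :
    (s * m - c) + (s * n - c) + (n - s) + (s - 2) + (m - s) =
      (m - s - 1) * (s + 1) + (n - s - 1) * (s + 1) + ((s + 1) ^ 2 - 1) := by
  obtain ⟨p, rfl⟩ := Nat.exists_eq_add_of_le hm
  obtain ⟨q, rfl⟩ := Nat.exists_eq_add_of_le hn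
  have e1 : s * (s + 1 + p) = 2 * c + s * p := by rw [hc]; ring
  have e2 : s * (s + 1 + q) = 2 * c + s * q := by rw [hc]; ring
  have e3 : (s + 1) ^ 2 = 2 * c + s + 1 := by rw [hc]; ring
  have e4 : s + 1 + p - s - 1 = p := by omega
  have e5 : s + 1 + q - s - 1 = q := by omega
  rw [e1, e2, e3, e4, e5, mul_add, mul_add, mul_comm p s, mul_comm q s]
  omega

end Stair

/-- For the staircase antichain `A = {(1,s),(2,s−1),…,(s,1)}` in `[m] × [n]` with
`m, n ≥ s + 1` and `s ≥ 2`, the dimension of the tangent space `T_A` equals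
`sm − C(s+1,2) + sn − C(s+1,2) + (n−s) + (s−2) + (m−s)`, which equals
`(m−s−1)(s+1) + (n−s−1)(s+1) + (s+1)² − 1`. -/
theorem stmt15 {k : Type*} [Field k] (m n s : ℕ)
    (hs : 2 ≤ s) (hm : s + 1 ≤ m) (hn : s + 1 ≤ n) :
    tdim k m n {v | ∃ ℓ, 1 ≤ ℓ ∧ ℓ ≤ s ∧ v.1 ≤ ℓ ∧ v.2 ≤ s + 1 - ℓ} =
      (s * m - (s + 1).choose 2) + (s * n - (s + 1).choose 2) +
        (n - s) + (s - 2) + (m - s) ∧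
    (s * m - (s + 1).choose 2) + (s * n - (s + 1).choose 2) +
        (n - s) + (s - 2) + (m - s) =
      (m - s - 1) * (s + 1) + (n - s - 1) * (s + 1) + ((s + 1) ^ 2 - 1) := by

  classical
  refine ⟨?_, ?_⟩
  · have h1 := Stair.finrank_TA (k := k) hs hm hn
    have h2 := Fintype.card_of_bijective (Stair.toIx_bij hs hm hn)
    refine h1.trans ?_
    rw [← h2]
    have e1 := Stair.sum1 m s hm
    have e2 := Stair.sum2 n s hn
    simp only [Fintype.card_sum, Fintype.card_sigma, Fintype.card_fin]
    omega
  · apply Stair.arith m n s _ hs hm hn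
    rw [Nat.choose_two_right, Nat.add_sub_cancel, mul_comm (s + 1) s]
    exact Nat.mul_div_cancel' (Nat.even_mul_succ_self s).two_dvd
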